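/- The resolvent J_f is firmly nonexpansive: for all x₁, x₂ ∈ H, if z₁ ∈ J_f x₁ and z₂ ∈ J_f x₂, then ‖z₁ − z₂‖² ≤ ⟨x₁ − x₂, z₁ − z₂⟩. -/

import Mathlib

open scoped RealInnerProductSpace

/-- The resolvent `J_f` is firmly nonexpansive: for all `x₁, x₂ ∈ H`,
if `z₁ ∈ J_f x₁` and `z₂ ∈ J_f x₂`, then `‖z₁ - z₂‖² ≤ ⟪x₁ - x₂, z₁ - z₂⟫`. -/
theorem resolvent_firmlyNonexpansive
    {H : Type*} [NormedAddCommGroup H] [InnerProductSpace ℝ H] [CompleteSpace H]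
    (K : Set H) (hK_ne : K.Nonempty) (hK_closed : IsClosed K) (hK_convex : Convex ℝ K)
    (f : H → H → ℝ)
    (h1 : ∀ x ∈ K, f x x = 0)
    (h2 : ∀ x ∈ K, ∀ y ∈ K, f x y + f y x ≤ 0)
    (h3lsc : ∀ x ∈ K, LowerSemicontinuousOn (f x) K)
    (h3conv : ∀ x ∈ K, ConvexOn ℝ K (f x))
    (h4 : ∀ y ∈ K, ∀ x ∈ K, ∀ w ∈ K,
      Filter.limsup (fun t : ℝ => f ((1 - t) • x + t • w) y) (nhdsWithin 0 (Set.Ioi 0))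
        ≤ f x y)
    (x₁ x₂ : H) (z₁ z₂ : H)
    (hz₁ : z₁ ∈ K ∧ ∀ y ∈ K, 0 ≤ f z₁ y + ⟪z₁ - x₁, y - z₁⟫)
    (hz₂ : z₂ ∈ K ∧ ∀ y ∈ K, 0 ≤ f z₂ y + ⟪z₂ - x₂, y - z₂⟫) :
    ‖z₁ - z₂‖ ^ 2 ≤ ⟪x₁ - x₂, z₁ - z₂⟫ := by
  have hsum : 0 ≤ ⟪z₁ - x₁, z₂ - z₁⟫ + ⟪z₂ - x₂, z₁ - z₂⟫ := by
    linarith [hz₁.2 z₂ hz₂.1, hz₂.2 z₁ hz₁.1, h2 z₁ hz₁.1 z₂ hz₂.1]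
  have hid : ⟪z₁ - x₁, z₂ - z₁⟫ + ⟪z₂ - x₂, z₁ - z₂⟫ =
      ⟪x₁ - x₂, z₁ - z₂⟫ - ‖z₁ - z₂‖ ^ 2 := by
    rw [← real_inner_self_eq_norm_sq, ← neg_sub z₁ z₂, inner_neg_right]
    simp only [inner_sub_left]
    ring
  linarith
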